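/- arXiv:2510.04008 — 3 statements merged into one kernel-verified Lean document; each statement's English description precedes it below -/
import Mathlib

section
/- Let S, Δ ∈ ℝ^{N×N}, set Ŝ := S + Δ, D := diag(S𝟏), E := diag(Δ𝟏), D̂ := D + E, with all diagonal entries of D positive and s_min := min_i D_{ii}. Define A := D^{-1}S and Â := D̂^{-1}Ŝ. If ‖E‖₂ ≤ s_min/2, then ‖Â − A‖₂ ≤ 2‖Δ‖₂/s_min + (2‖S‖₂/s_min²)·√N·‖Δ‖₂. -/
open Matrix

/-- Spectral norm (operator norm induced by the Euclidean norm) of a real matrix. -/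
noncomputable def specNorm {m n : ℕ} (M : Matrix (Fin m) (Fin n) ℝ) : ℝ :=
  ‖LinearMap.toContinuousLinearMap (Matrix.toEuclideanLin M)‖

/-- The row-normalization diagonal matrix `diag(M𝟏)` of a square real matrix. -/
noncomputable def rowSumDiag {N : ℕ} (M : Matrix (Fin N) (Fin N) ℝ) :
    Matrix (Fin N) (Fin N) ℝ :=
  Matrix.diagonal fun i => ∑ j, M i j

open scoped Matrix.Norms.L2Operator in
theorem specNorm_eq_l2_opNorm {m n : ℕ} (M : Matrix (Fin m) (Fin n) ℝ) : specNorm M = ‖M‖ := rfl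

theorem specNorm_nonneg {m n : ℕ} (M : Matrix (Fin m) (Fin n) ℝ) : 0 ≤ specNorm M :=
  norm_nonneg _

open scoped Matrix.Norms.L2Operator in
theorem specNorm_add_le {m n : ℕ} (M M' : Matrix (Fin m) (Fin n) ℝ) :
    specNorm (M + M') ≤ specNorm M + specNorm M' := by
  simpa only [specNorm_eq_l2_opNorm] using norm_add_le M M'

open scoped Matrix.Norms.L2Operator in
theorem specNorm_diagonal {n : ℕ} (v : Fin n → ℝ) : specNorm (diagonal v) = ‖v‖ := by
  rw [specNorm_eq_l2_opNorm, l2_opNorm_diagonal]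

open scoped Matrix.Norms.L2Operator in
theorem specNorm_diagonal_mul_le {m n : ℕ} {v : Fin m → ℝ} {c : ℝ} (hc : 0 ≤ c)
    (hv : ∀ i, |v i| ≤ c) (M : Matrix (Fin m) (Fin n) ℝ) :
    specNorm (diagonal v * M) ≤ c * specNorm M := by
  refine (l2_opNorm_mul (diagonal v) M).trans ?_
  rw [l2_opNorm_diagonal]
  exact mul_le_mul_of_nonneg_right ((pi_norm_le_iff_of_nonneg hc).2 hv) (specNorm_nonneg M)

/-- Each row sum is a coordinate of `M𝟏`, and `𝟏` has Euclidean norm `√n`. -/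
theorem abs_row_sum_le {m n : ℕ} (M : Matrix (Fin m) (Fin n) ℝ) (i : Fin m) :
    |∑ j, M i j| ≤ Real.sqrt n * specNorm M := by
  let u : EuclideanSpace ℝ (Fin n) := WithLp.toLp 2 fun _ => 1
  have hu : ‖u‖ = Real.sqrt n := by simp [u, EuclideanSpace.norm_eq]
  have h := (LinearMap.toContinuousLinearMap (toEuclideanLin M)).le_opNorm u
  have hi := (PiLp.norm_apply_le (toEuclideanLin M u) i).trans h
  rw [hu, mul_comm] at hi
  simpa [u, specNorm, mulVec, dotProduct] using hi

theorem inv_diagonal_of_ne_zero {n : ℕ} {v : Fin n → ℝ} (hv : ∀ i, v i ≠ 0) :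
    (diagonal v)⁻¹ = diagonal fun i => (v i)⁻¹ := by
  refine inv_eq_left_inv ?_
  rw [diagonal_mul_diagonal, ← diagonal_one]
  exact congrArg diagonal (funext fun i => inv_mul_cancel₀ (hv i))

/-- With `Ŝ = S + Δ`, `D = diag(S𝟏)`, `E = diag(Δ𝟏)`, `D̂ = D + E`,
all diagonal entries of `D` positive, `s_min = min_i D_{ii}`, `A = D⁻¹S`, `Â = D̂⁻¹Ŝ`:
if `‖E‖₂ ≤ s_min/2` then `‖Â − A‖₂ ≤ 2‖Δ‖₂/s_min + (2‖S‖₂/s_min²)√N‖Δ‖₂`. -/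
theorem race_attention_deviation {N : ℕ} (S Δ : Matrix (Fin N) (Fin N) ℝ)
    (hD : ∀ i, 0 < ∑ j, S i j)
    (smin : ℝ) (hmin : ∀ i, smin ≤ ∑ j, S i j) (hex : ∃ i, ∑ j, S i j = smin)
    (hE : specNorm (rowSumDiag Δ) ≤ smin / 2) :
    specNorm ((rowSumDiag S + rowSumDiag Δ)⁻¹ * (S + Δ) - (rowSumDiag S)⁻¹ * S)
      ≤ 2 * specNorm Δ / smin
        + (2 * specNorm S / smin ^ 2) * Real.sqrt N * specNorm Δ := by
  obtain ⟨k, hk⟩ := hex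
  have hs : 0 < smin := hk ▸ hD k
  have he : ∀ i, |∑ j, Δ i j| ≤ smin / 2 := fun i => by
    rw [rowSumDiag, specNorm_diagonal] at hE
    exact (norm_le_pi_norm (fun i => ∑ j, Δ i j) i).trans hE
  have hsum : ∀ i, smin / 2 ≤ ∑ j, S i j + ∑ j, Δ i j := fun i => by
    linarith [hmin i, (abs_le.1 (he i)).1]
  have hpos : ∀ i, 0 < ∑ j, S i j + ∑ j, Δ i j := fun i => (half_pos hs).trans_le (hsum i)
  have hΔ := specNorm_nonneg Δ
  have hsplit : (rowSumDiag S + rowSumDiag Δ)⁻¹ * (S + Δ) - (rowSumDiag S)⁻¹ * S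
      = diagonal (fun i => (∑ j, S i j + ∑ j, Δ i j)⁻¹) * Δ
        + diagonal (fun i => (∑ j, S i j + ∑ j, Δ i j)⁻¹ - (∑ j, S i j)⁻¹) * S := by
    rw [rowSumDiag, rowSumDiag, diagonal_add, inv_diagonal_of_ne_zero fun i => (hpos i).ne',
      inv_diagonal_of_ne_zero fun i => (hD i).ne', ← diagonal_sub, mul_add, sub_mul]
    abel
  have hinv : ∀ i, |(∑ j, S i j + ∑ j, Δ i j)⁻¹| ≤ 2 / smin := fun i => by
    rw [abs_of_pos (inv_pos.2 (hpos i)), ← inv_div]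
    exact inv_anti₀ (half_pos hs) (hsum i)
  have hdiff : ∀ i, |(∑ j, S i j + ∑ j, Δ i j)⁻¹ - (∑ j, S i j)⁻¹|
      ≤ Real.sqrt N * specNorm Δ / (smin / 2 * smin) := fun i => by
    rw [inv_sub_inv (hpos i).ne' (hD i).ne', abs_div, abs_of_pos (mul_pos (hpos i) (hD i)),
      sub_add_cancel_left, abs_neg]
    exact div_le_div₀ (by positivity) (abs_row_sum_le Δ i) (by positivity)
      (mul_le_mul (hsum i) (hmin i) hs.le (hpos i).le)
  rw [hsplit]
  calc _ ≤ 2 / smin * specNorm Δ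
        + Real.sqrt N * specNorm Δ / (smin / 2 * smin) * specNorm S :=
        (specNorm_add_le _ _).trans (add_le_add
          (specNorm_diagonal_mul_le (by positivity) hinv Δ)
          (specNorm_diagonal_mul_le (by positivity) hdiff S))
    _ = _ := by field_simp
end

section
/- Let (Ω, 𝒫) be a probability space and let p, q : Ω → ℝ^R be integrable random probability vectors (each entry nonnegative and entries summing to one, pointwise). Let a, b : Ω → {1,…,R} be measurable selections with p_{a(ω)}(ω) = max_r p_r(ω) and q_{b(ω)}(ω) = max_r q_r(ω) for all ω. Then |𝔼[⟨p, q⟩] − 𝒫(a = b)| ≤ 𝔼[1 − p_a] + 𝔼[1 − q_b]. -/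
open MeasureTheory

open Finset in
/-- The inner product of two probability vectors differs from the indicator of `a = b` by at most
the mass `x` puts off `a` plus the mass `y` puts off `b`. -/
theorem abs_sum_mul_sub_ite_le {ι : Type*} [Fintype ι] [DecidableEq ι] {x y : ι → ℝ}
    (hx0 : ∀ i, 0 ≤ x i) (hx1 : ∑ i, x i = 1) (hy0 : ∀ i, 0 ≤ y i) (hy1 : ∑ i, y i = 1)
    (a b : ι) :
    |∑ i, x i * y i - (if a = b then 1 else 0)| ≤ (1 - x a) + (1 - y b) := by
  have hx (i : ι) : x i ≤ 1 := hx1 ▸ single_le_sum (fun j _ => hx0 j) (mem_univ i)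
  have hy (i : ι) : y i ≤ 1 := hy1 ▸ single_le_sum (fun j _ => hy0 j) (mem_univ i)
  have hlower : x a * y a ≤ ∑ i, x i * y i :=
    single_le_sum (f := fun i => x i * y i) (fun j _ => mul_nonneg (hx0 j) (hy0 j)) (mem_univ a)
  have hupper : x a * (1 - y a) ≤ 1 - ∑ i, x i * y i :=
    calc x a * (1 - y a) ≤ ∑ i, x i * (1 - y i) :=
          single_le_sum (f := fun i => x i * (1 - y i))
            (fun j _ => mul_nonneg (hx0 j) (sub_nonneg.2 (hy j))) (mem_univ a)
      _ = 1 - ∑ i, x i * y i := by simp only [mul_sub, mul_one, sum_sub_distrib, hx1]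
  have hxy := mul_nonneg (sub_nonneg.2 (hx a)) (sub_nonneg.2 (hy a))
  have hxa := mul_nonneg (hx0 a) (sub_nonneg.2 (hy a))
  have hya := mul_nonneg (sub_nonneg.2 (hx a)) (hy0 a)
  have hprod := mul_nonneg (hx0 a) (hy0 a)
  split_ifs with hab
  · subst hab
    rw [abs_le]
    constructor <;> nlinarith
  · have hpair : y a + y b ≤ 1 := by
      rw [← sum_pair hab, ← hy1]
      exact sum_le_sum_of_subset_of_nonneg (subset_univ _) fun j _ _ => hy0 j
    rw [sub_zero, abs_le]
    constructor <;> nlinarith [hx a, hy b]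

/-- Evaluating finitely many integrable functions at a measurable random index gives an integrable
function. -/
theorem integrable_apply_measurable_index {Ω ι E : Type*} [MeasurableSpace Ω] {μ : Measure Ω}
    [Fintype ι] [MeasurableSpace ι] [MeasurableSingletonClass ι] [NormedAddCommGroup E]
    {f : Ω → ι → E} (hf : ∀ i, Integrable (fun ω => f ω i) μ) {a : Ω → ι} (ha : Measurable a) :
    Integrable (fun ω => f ω (a ω)) μ := by
  classical
  have h : (fun ω => f ω (a ω)) =
      fun ω => ∑ i, (a ⁻¹' {i}).indicator (fun ω => f ω i) ω := by
    ext ω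
    simp [Set.indicator_apply]
  rw [h]
  exact integrable_finsetSum _ fun i _ => (hf i).indicator (ha (measurableSet_singleton i))

/-- For integrable random probability vectors `p, q : Ω → ℝ^R` with
measurable argmax selections `a, b : Ω → Fin R`,
`|𝔼[⟨p,q⟩] − 𝒫(a = b)| ≤ 𝔼[1 − p_a] + 𝔼[1 − q_b]`. -/
theorem race_integrated_inner_indicator_bound {R : ℕ} {Ω : Type*} [MeasurableSpace Ω]
    (μ : Measure Ω) [IsProbabilityMeasure μ]
    (p q : Ω → Fin R → ℝ)
    (hpint : ∀ r, Integrable (fun ω => p ω r) μ)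
    (hqint : ∀ r, Integrable (fun ω => q ω r) μ)
    (hp0 : ∀ ω r, 0 ≤ p ω r) (hp1 : ∀ ω, ∑ r, p ω r = 1)
    (hq0 : ∀ ω r, 0 ≤ q ω r) (hq1 : ∀ ω, ∑ r, q ω r = 1)
    (a b : Ω → Fin R) (hameas : Measurable a) (hbmeas : Measurable b)
    (ha : ∀ ω r, p ω r ≤ p ω (a ω)) (hb : ∀ ω r, q ω r ≤ q ω (b ω)) :
    |(∫ ω, ∑ r, p ω r * q ω r ∂μ) - (μ {ω | a ω = b ω}).toReal|
      ≤ (∫ ω, (1 - p ω (a ω)) ∂μ) + ∫ ω, (1 - q ω (b ω)) ∂μ := by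
  have hS : Integrable (fun ω => ∑ r, p ω r * q ω r) μ := by
    refine integrable_finsetSum _ fun r _ => (hqint r).bdd_mul (c := 1)
      (hpint r).aestronglyMeasurable (.of_forall fun ω => ?_)
    rw [Real.norm_of_nonneg (hp0 ω r), ← hp1 ω]
    exact Finset.single_le_sum (fun j _ => hp0 ω j) (Finset.mem_univ r)
  have hmeas : MeasurableSet {ω | a ω = b ω} := measurableSet_eq_fun hameas hbmeas
  have hind : Integrable ({ω | a ω = b ω}.indicator (1 : Ω → ℝ)) μ :=
    (integrable_const (1 : ℝ)).indicator hmeas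
  have hpa : Integrable (fun ω => 1 - p ω (a ω)) μ :=
    (integrable_const 1).sub (integrable_apply_measurable_index hpint hameas)
  have hqb : Integrable (fun ω => 1 - q ω (b ω)) μ :=
    (integrable_const 1).sub (integrable_apply_measurable_index hqint hbmeas)
  rw [← measureReal_def, ← integral_indicator_one hmeas, ← integral_sub hS hind,
    ← integral_add hpa hqb]
  refine abs_integral_le_integral_abs.trans
    (integral_mono (hS.sub hind).abs (hpa.add hqb) fun ω => ?_)
  simpa [Set.indicator_apply] using
    abs_sum_mul_sub_ite_le (hp0 ω) (hp1 ω) (hq0 ω) (hq1 ω) (a ω) (b ω)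
end

section
/- Let x, y ∈ ℝ^d be unit vectors and let w be a random vector in ℝ^d whose d coordinates are independent standard Gaussians (i.e., w has law the d-fold product of N(0,1)). Then the probability that ⟨w, x⟩ and ⟨w, y⟩ have the same sign equals 1 − arccos(⟨x, y⟩)/π; equivalently, P(sign(⟨w,x⟩) = sign(⟨w,y⟩)) = 1 − θ/π where θ = arccos(⟨x,y⟩) is the angle between x and y. (The events ⟨w,x⟩ = 0 or ⟨w,y⟩ = 0 have probability zero.) -/
open MeasureTheory ProbabilityTheory

open Matrix in
/-- The characteristic function of a linear image of a standard Gaussian vector. -/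
lemma charFun_map_mulVec_pi_gaussianReal {ι m : Type*} [Fintype ι] [Fintype m]
    (A : Matrix m ι ℝ) (t : EuclideanSpace ℝ m) :
    charFun ((Measure.pi fun _ : ι => gaussianReal 0 1).map fun w => WithLp.toLp 2 (A *ᵥ w)) t
      = Complex.exp (-((t.ofLp ⬝ᵥ (A * Aᵀ) *ᵥ t.ofLp : ℝ) : ℂ) / 2) := by
  have key := charFun_stdGaussian (WithLp.toLp 2 (Aᵀ *ᵥ t.ofLp) : EuclideanSpace ℝ ι)
  rw [← map_pi_eq_stdGaussian, charFun_apply,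
    integral_map (Measurable.aemeasurable (by fun_prop))
      (Measurable.aestronglyMeasurable (by fun_prop))] at key
  rw [charFun_apply, integral_map (Measurable.aemeasurable (by fun_prop))
    (Measurable.aestronglyMeasurable (by fun_prop))]
  convert key using 1
  · congr 1 with w
    simp only [EuclideanSpace.inner_eq_star_dotProduct, star_trivial]
    rw [dotProduct_mulVec, mulVec_transpose]
  · rw [← Complex.ofReal_pow, EuclideanSpace.real_norm_sq_eq]
    congr 4
    simp only [pow_two]
    change _ = (Aᵀ *ᵥ t.ofLp) ⬝ᵥ (Aᵀ *ᵥ t.ofLp)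
    rw [dotProduct_mulVec, ← vecMul_vecMul, ← dotProduct_mulVec, mulVec_transpose]

open Matrix in
/-- The law of a linear image `A *ᵥ w` of a standard Gaussian vector depends only on `A * Aᵀ`. -/
lemma map_mulVec_pi_gaussianReal_congr {ι κ m : Type*} [Fintype ι] [Fintype κ] [Fintype m]
    {A : Matrix m ι ℝ} {B : Matrix m κ ℝ} (h : A * Aᵀ = B * Bᵀ) :
    (Measure.pi fun _ : ι => gaussianReal 0 1).map (A *ᵥ ·)
      = (Measure.pi fun _ : κ => gaussianReal 0 1).map (B *ᵥ ·) := by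
  have hmap : (Measure.pi fun _ : ι => gaussianReal 0 1).map (fun w => WithLp.toLp 2 (A *ᵥ w))
      = (Measure.pi fun _ : κ => gaussianReal 0 1).map (fun w => WithLp.toLp 2 (B *ᵥ w)) := by
    apply Measure.ext_of_charFun (E := EuclideanSpace ℝ m)
    ext t
    rw [charFun_map_mulVec_pi_gaussianReal, charFun_map_mulVec_pi_gaussianReal, h]
  have := congrArg (Measure.map (WithLp.ofLp (p := 2))) hmap
  rwa [Measure.map_map (by fun_prop) (by fun_prop), Measure.map_map (by fun_prop) (by fun_prop)]
    at this

/-- The standard Gaussian measure on the plane has a rotation invariant density. -/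
lemma gaussianReal_prod_self_eq_withDensity :
    (gaussianReal 0 1).prod (gaussianReal 0 1) = (volume : Measure (ℝ × ℝ)).withDensity
      fun z => ENNReal.ofReal ((2 * Real.pi)⁻¹ * Real.exp (-(z.1 ^ 2 + z.2 ^ 2) / 2)) := by
  rw [gaussianReal_of_var_ne_zero _ one_ne_zero,
    prod_withDensity (measurable_gaussianPDF 0 1) (measurable_gaussianPDF 0 1),
    ← Measure.volume_eq_prod]
  congr 1 with z
  rw [gaussianPDF, gaussianPDF, ← ENNReal.ofReal_mul (gaussianPDFReal_nonneg _ _ _)]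
  congr 1
  simp only [gaussianPDFReal, NNReal.coe_one, mul_one, sub_zero]
  rw [mul_mul_mul_comm, ← mul_inv, Real.mul_self_sqrt (by positivity), ← Real.exp_add]
  ring_nf

/-- A centered planar cone has standard Gaussian measure proportional to its angle. -/
lemma gaussianReal_prod_self_cone {S : Set (ℝ × ℝ)} {T : Set ℝ} (hS : MeasurableSet S)
    (hT : MeasurableSet T) (h : ∀ r > 0, ∀ φ, (r * Real.cos φ, r * Real.sin φ) ∈ S ↔ φ ∈ T) :
    (gaussianReal 0 1).prod (gaussianReal 0 1) S
      = (ENNReal.ofReal (2 * Real.pi))⁻¹ * volume (T ∩ Set.Ioo (-Real.pi) Real.pi) := by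
  obtain ⟨K, hK⟩ : ∃ K, ∀ (S : Set (ℝ × ℝ)) (T : Set ℝ), MeasurableSet S → MeasurableSet T →
      (∀ r > 0, ∀ φ, (r * Real.cos φ, r * Real.sin φ) ∈ S ↔ φ ∈ T) →
      (gaussianReal 0 1).prod (gaussianReal 0 1) S
        = K * volume (T ∩ Set.Ioo (-Real.pi) Real.pi) := by
    refine ⟨∫⁻ r in Set.Ioi (0 : ℝ), ENNReal.ofReal r *
      ENNReal.ofReal ((2 * Real.pi)⁻¹ * Real.exp (-r ^ 2 / 2)), fun S T hS hT h => ?_⟩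
    have htarget : polarCoord.target = Set.Ioi (0 : ℝ) ×ˢ Set.Ioo (-Real.pi) Real.pi := rfl
    rw [gaussianReal_prod_self_eq_withDensity, withDensity_apply _ hS, ← lintegral_indicator hS,
      ← lintegral_comp_polarCoord_symm, ← Measure.restrict_apply hT, ← lintegral_indicator_one hT,
      ← lintegral_prod_mul (by fun_prop) (measurable_one.indicator hT).aemeasurable,
      Measure.prod_restrict, ← Measure.volume_eq_prod, htarget]
    refine setLIntegral_congr_fun (measurableSet_Ioi.prod measurableSet_Ioo) fun p hp => ?_
    have hp' := h p.1 hp.1 p.2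
    by_cases hφ : p.2 ∈ T
    · simp only [polarCoord_symm_apply, Set.indicator_of_mem (hp'.2 hφ), Set.indicator_of_mem hφ,
        smul_eq_mul, Pi.one_apply, mul_one, mul_pow, ← mul_add, Real.cos_sq_add_sin_sq]
    · simp only [polarCoord_symm_apply, Set.indicator_of_notMem (mt hp'.1 hφ),
        Set.indicator_of_notMem hφ, smul_zero, mul_zero]
  have huniv := hK Set.univ Set.univ .univ .univ (by simp)
  rw [measure_univ, Set.univ_inter, Real.volume_Ioo, sub_neg_eq_add, ← two_mul] at huniv
  rw [hK S T hS hT h, ENNReal.eq_inv_of_mul_eq_one_left huniv.symm]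

lemma Real.sign_eq_sign_of_mul_pos {a b : ℝ} (h : 0 < a * b) : Real.sign a = Real.sign b := by
  rcases mul_pos_iff.1 h with ⟨ha, hb⟩ | ⟨ha, hb⟩
  · rw [Real.sign_of_pos ha, Real.sign_of_pos hb]
  · rw [Real.sign_of_neg ha, Real.sign_of_neg hb]

lemma Real.mul_nonneg_of_sign_eq_sign {a b : ℝ} (h : Real.sign a = Real.sign b) : 0 ≤ a * b := by
  rcases lt_trichotomy b 0 with hb | rfl | hb
  · refine mul_nonneg_of_nonpos_of_nonpos (not_lt.1 fun ha => ?_) hb.le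
    rw [Real.sign_of_pos ha, Real.sign_of_neg hb] at h
    norm_num at h
  · simp
  · refine mul_nonneg (not_lt.1 fun ha => ?_) hb.le
    rw [Real.sign_of_neg ha, Real.sign_of_pos hb] at h
    norm_num at h

lemma Real.sign_mul_of_pos {r : ℝ} (hr : 0 < r) (a : ℝ) : Real.sign (r * a) = Real.sign a := by
  have hneg : r * a < 0 ↔ a < 0 := by simp [mul_neg_iff, hr, hr.not_gt]
  simp only [Real.sign, hneg, mul_pos_iff_of_pos_left hr]

lemma Real.measurable_sign : Measurable Real.sign :=
  .ite measurableSet_Iio measurable_const (.ite measurableSet_Ioi measurable_const measurable_const)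

lemma volume_setOf_sign_cos_add_eq_sign_cos_sub {θ : ℝ} (h0 : 0 ≤ θ) (hπ : θ ≤ Real.pi) :
    volume ({φ | Real.sign (Real.cos (φ + θ / 2)) = Real.sign (Real.cos (φ - θ / 2))} ∩
      Set.Ioo (-Real.pi) Real.pi) = ENNReal.ofReal (2 * Real.pi - 2 * θ) := by
  set T := {φ | Real.sign (Real.cos (φ + θ / 2)) = Real.sign (Real.cos (φ - θ / 2))} ∩
      Set.Ioo (-Real.pi) Real.pi
  have hprod (φ : ℝ) : 2 * (Real.cos (φ + θ / 2) * Real.cos (φ - θ / 2))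
      = Real.cos |2 * φ| - Real.cos (Real.pi - θ) := by
    rw [Real.cos_abs, Real.cos_pi_sub, Real.cos_add, Real.cos_sub, Real.cos_two_mul,
      show Real.cos θ = Real.cos (2 * (θ / 2)) by ring_nf, Real.cos_two_mul]
    nlinarith [Real.sin_sq_add_cos_sq φ, Real.sin_sq_add_cos_sq (θ / 2)]
  have hpos (u : ℝ) (hu0 : 0 ≤ u) (hu : u ≤ 2 * Real.pi)
      (h : u < Real.pi - θ ∨ Real.pi + θ < u) : Real.cos (Real.pi - θ) < Real.cos u := by
    rcases h with h | h
    · exact Real.cos_lt_cos_of_nonneg_of_le_pi hu0 (by linarith) h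
    · rw [← Real.cos_two_pi_sub u]
      exact Real.cos_lt_cos_of_nonneg_of_le_pi (by linarith) (by linarith) (by linarith)
  have hneg (u : ℝ) (h₁ : Real.pi - θ < u) (h₂ : u < Real.pi + θ) :
      Real.cos u < Real.cos (Real.pi - θ) := by
    rcases le_total u Real.pi with h | h
    · exact Real.cos_lt_cos_of_nonneg_of_le_pi (by linarith) h h₁
    · rw [← Real.cos_two_pi_sub u]
      exact Real.cos_lt_cos_of_nonneg_of_le_pi (by linarith) (by linarith) (by linarith)
  have hlower : Set.Ioo (-((Real.pi - θ) / 2)) ((Real.pi - θ) / 2) ∪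
      (Set.Ioo (-Real.pi) (-((Real.pi + θ) / 2)) ∪ Set.Ioo ((Real.pi + θ) / 2) Real.pi) ⊆ T := by
    intro φ hφ
    have hmem : φ ∈ Set.Ioo (-Real.pi) Real.pi := by
      rcases hφ with h | h | h <;> constructor <;> linarith [h.1, h.2]
    refine ⟨Real.sign_eq_sign_of_mul_pos ?_, hmem⟩
    have := hpos |2 * φ| (abs_nonneg _) (abs_le.2 ⟨by linarith [hmem.1], by linarith [hmem.2]⟩) <| by
      rw [abs_lt, lt_abs]
      rcases hφ with h | h | h
      · exact .inl ⟨by linarith [h.1], by linarith [h.2]⟩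
      · exact .inr (.inr (by linarith [h.2]))
      · exact .inr (.inl (by linarith [h.1]))
    linarith [hprod φ]
  have hupper : T ⊆ Set.Icc (-((Real.pi - θ) / 2)) ((Real.pi - θ) / 2) ∪
      (Set.Icc (-Real.pi) (-((Real.pi + θ) / 2)) ∪ Set.Icc ((Real.pi + θ) / 2) Real.pi) := by
    rintro φ ⟨hsign, hmem⟩
    have hnonneg := Real.mul_nonneg_of_sign_eq_sign hsign
    have : |2 * φ| ≤ Real.pi - θ ∨ Real.pi + θ ≤ |2 * φ| := by
      by_contra! h
      linarith [hprod φ, hneg _ h.1 h.2]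
    rw [abs_le, le_abs] at this
    rcases this with h | h | h
    · exact .inl ⟨by linarith [h.1], by linarith [h.2]⟩
    · exact .inr (.inr ⟨by linarith, hmem.2.le⟩)
    · exact .inr (.inl ⟨hmem.1.le, by linarith⟩)
  have hlen : ENNReal.ofReal ((Real.pi - θ) / 2 - -((Real.pi - θ) / 2)) +
      (ENNReal.ofReal (-((Real.pi + θ) / 2) - -Real.pi)
        + ENNReal.ofReal (Real.pi - (Real.pi + θ) / 2)) = ENNReal.ofReal (2 * Real.pi - 2 * θ) := by
    rw [← ENNReal.ofReal_add (by linarith) (by linarith),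
      ← ENNReal.ofReal_add (by linarith) (by linarith)]
    ring_nf
  apply le_antisymm
  · refine (measure_mono hupper).trans ((measure_union_le _ _).trans ?_)
    refine (add_le_add_right (measure_union_le _ _) _).trans ?_
    simp only [Real.volume_Icc]
    exact hlen.le
  · refine le_trans ?_ (measure_mono hlower)
    rw [measure_union _ (measurableSet_Ioo.union measurableSet_Ioo),
      measure_union _ measurableSet_Ioo]
    · simp only [Real.volume_Ioo]
      exact hlen.ge
    · exact Set.disjoint_left.2 fun φ h1 h2 => by linarith [h1.2, h2.1]
    · refine Set.disjoint_left.2 fun φ h1 h2 => ?_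
      rcases h2 with h2 | h2 <;> linarith [h1.1, h1.2, h2.1, h2.2]

/-- For unit vectors `x, y ∈ ℝ^d` and `w` a standard Gaussian random
vector in `ℝ^d` (law the `d`-fold product of `N(0,1)`), the probability that
`⟨w,x⟩` and `⟨w,y⟩` have the same sign is `1 − arccos(⟨x,y⟩)/π`. -/
theorem race_simhash_collision_probability {d : ℕ} (x y : Fin d → ℝ)
    (hx : ∑ i, x i ^ 2 = 1) (hy : ∑ i, y i ^ 2 = 1) :
    (Measure.pi fun _ : Fin d => gaussianReal 0 1)
        {w | Real.sign (∑ i, w i * x i) = Real.sign (∑ i, w i * y i)}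
      = ENNReal.ofReal (1 - Real.arccos (∑ i, x i * y i) / Real.pi) := by
  set θ := Real.arccos (∑ i, x i * y i)
  have h0 : 0 ≤ θ := Real.arccos_nonneg _
  have hπ : θ ≤ Real.pi := Real.arccos_le_pi _
  have hcos : Real.cos θ = ∑ i, x i * y i := by
    have hsq := Finset.sum_mul_sq_le_sq_mul_sq Finset.univ x y
    rw [hx, hy, one_mul, sq_le_one_iff_abs_le_one, abs_le] at hsq
    exact Real.cos_arccos hsq.1 hsq.2
  set c := Real.cos (θ / 2)
  set s := Real.sin (θ / 2)
  have hcs : c ^ 2 + s ^ 2 = 1 := Real.cos_sq_add_sin_sq _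
  have hcs' : c * c - s * s = ∑ i, x i * y i := by
    rw [← hcos, ← Real.cos_add, add_halves]
  have hlaw := map_mulVec_pi_gaussianReal_congr
    (A := Matrix.of ![x, y]) (B := Matrix.of ![![c, -s], ![c, s]]) (by
      ext i j
      fin_cases i <;> fin_cases j <;>
        simp [Matrix.mul_apply, Fin.sum_univ_two, ← hcs', ← pow_two, hx, hy, hcs]
      · ring
      · simp only [mul_comm (y _), ← hcs']
        ring)
  have hmeas : MeasurableSet {v : Fin 2 → ℝ | Real.sign (v 0) = Real.sign (v 1)} :=
    measurableSet_eq_fun (Real.measurable_sign.comp (measurable_pi_apply 0))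
      (Real.measurable_sign.comp (measurable_pi_apply 1))
  have hmeas_prod : MeasurableSet {z : ℝ × ℝ |
      Real.sign (z.1 * c - z.2 * s) = Real.sign (z.1 * c + z.2 * s)} :=
    measurableSet_eq_fun (Real.measurable_sign.comp (by fun_prop))
      (Real.measurable_sign.comp (by fun_prop))
  have hmeas_cos : MeasurableSet {φ | Real.sign (Real.cos (φ + θ / 2))
      = Real.sign (Real.cos (φ - θ / 2))} :=
    measurableSet_eq_fun (Real.measurable_sign.comp (by fun_prop))
      (Real.measurable_sign.comp (by fun_prop))
  have hplane : (Measure.pi fun _ : Fin d => gaussianReal 0 1)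
      {w | Real.sign (∑ i, w i * x i) = Real.sign (∑ i, w i * y i)}
      = (gaussianReal 0 1).prod (gaussianReal 0 1)
        {z : ℝ × ℝ | Real.sign (z.1 * c - z.2 * s) = Real.sign (z.1 * c + z.2 * s)} := by
    have happ := congrArg (· {v : Fin 2 → ℝ | Real.sign (v 0) = Real.sign (v 1)}) hlaw
    rw [Measure.map_apply (by fun_prop) hmeas, Measure.map_apply (by fun_prop) hmeas] at happ
    rw [← (measurePreserving_finTwoArrow (gaussianReal 0 1)).measure_preimage
      hmeas_prod.nullMeasurableSet]
    convert happ using 2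
    · ext w
      simp [dotProduct, mul_comm]
    · ext w
      simp [dotProduct, Fin.sum_univ_two, MeasurableEquiv.finTwoArrow, mul_comm,
        sub_eq_neg_add, add_comm]
  rw [hplane, gaussianReal_prod_self_cone hmeas_prod hmeas_cos,
    volume_setOf_sign_cos_add_eq_sign_cos_sub h0 hπ, mul_comm, ← div_eq_mul_inv,
    ← ENNReal.ofReal_div_of_pos (by positivity)]
  · congr 1
    field_simp
  · intro r hr φ
    simp only [Set.mem_ofPred_eq, Real.cos_add, Real.cos_sub, mul_assoc, ← mul_sub, ← mul_add]
    rw [Real.sign_mul_of_pos hr, Real.sign_mul_of_pos hr]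
end
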